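/- arXiv:hep-th/0308052 — 9 statements merged into one kernel-verified Lean document; each statement's English description precedes it below -/
import Mathlib

section
/- (Proposition 2.3) Let W, φ : U → ℝ be twice differentiable on an open set U ⊆ ℝ^r, let ℰ ∈ ℝ, and suppose −∑_{j=1}^r ∂W/∂q_j ∂φ/∂q_j = ℰ φ holds on U. If q̄ ∈ U satisfies ∂W/∂q_j(q̄) = 0 for all j, then for each k = 1,…,r: −∑_{j=1}^r ∂²W/∂q_k∂q_j(q̄) · ∂φ/∂q_j(q̄) = ℰ ∂φ/∂q_k(q̄). Hence, whenever the gradient ∇φ(q̄) is nonzero, it is an eigenvector of the negative Hessian matrix −W̃ = −[∂²W/∂q_j∂q_k(q̄)] with eigenvalue ℰ. -/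
/-- Partial derivative `∂f/∂q_j` of a function on `ℝ^r`. -/
noncomputable def pd {r : ℕ} (f : (Fin r → ℝ) → ℝ) (j : Fin r) (q : Fin r → ℝ) : ℝ :=
  fderiv ℝ f q (Pi.single j 1)

/-- Partial derivatives of a `C²` function on an open set are differentiable there. -/
theorem differentiableAt_pd {r : ℕ} {U : Set (Fin r → ℝ)} (hU : IsOpen U)
    {f : (Fin r → ℝ) → ℝ} (hf : ContDiffOn ℝ 2 f U) (j : Fin r) {q : Fin r → ℝ} (hq : q ∈ U) :
    DifferentiableAt ℝ (pd f j) q := by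
  have h : ContDiffAt ℝ 1 (fderiv ℝ f) q :=
    (hf.contDiffAt (hU.mem_nhds hq)).fderiv_right (by norm_num)
  exact (h.differentiableAt (by norm_num)).clm_apply (differentiableAt_const _)

/-- Proposition 2.3: for a classical eigenfunction `φ` of `Â = −∇W·∇` with eigenvalue
`ℰ`, at an equilibrium point `q̄` (where `∇W(q̄) = 0`) one has, for each `k`,
`−∑_j ∂²W/∂q_k∂q_j(q̄) ∂φ/∂q_j(q̄) = ℰ ∂φ/∂q_k(q̄)`; hence whenever `∇φ(q̄) ≠ 0`, it is
an eigenvector of the negative Hessian `−W̃` with eigenvalue `ℰ`. -/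
theorem gradient_is_hessian_eigenvector (r : ℕ)
    (U : Set (Fin r → ℝ)) (hU : IsOpen U)
    (W φ : (Fin r → ℝ) → ℝ)
    (hW : ContDiffOn ℝ 2 W U) (hφ : ContDiffOn ℝ 2 φ U)
    (E : ℝ)
    (heig : ∀ q ∈ U, -(∑ j, pd W j q * pd φ j q) = E * φ q)
    (qbar : Fin r → ℝ) (hqbar : qbar ∈ U)
    (hequil : ∀ j, pd W j qbar = 0) :
    (∀ k, -(∑ j, pd (pd W j) k qbar * pd φ j qbar) = E * pd φ k qbar)
    ∧ ((fun j => pd φ j qbar) ≠ 0 →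
        Matrix.mulVec (Matrix.of fun k j => -(pd (pd W j) k qbar)) (fun j => pd φ j qbar)
          = E • (fun j => pd φ j qbar)) := by
  have key : ∀ k, -(∑ j, pd (pd W j) k qbar * pd φ j qbar) = E * pd φ k qbar := by
    intro k
    have hφ' : DifferentiableAt ℝ φ qbar :=
      (hφ.contDiffAt (hU.mem_nhds hqbar)).differentiableAt (by norm_num)
    have hleft : HasFDerivAt (fun q => -(∑ j, pd W j q * pd φ j q)) _ qbar :=
      (HasFDerivAt.fun_sum fun j _ => (differentiableAt_pd hU hW j hqbar).hasFDerivAt.fun_mul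
        (differentiableAt_pd hU hφ j hqbar).hasFDerivAt).fun_neg
    have hright := (hφ'.hasFDerivAt.const_mul E).congr_of_eventuallyEq
      (Filter.eventually_of_mem (hU.mem_nhds hqbar) heig)
    have h := congrArg (fun L => L (Pi.single k 1)) (hleft.unique hright)
    have hzero : ∀ j, fderiv ℝ W qbar (Pi.single j 1) = 0 := hequil
    simpa [hzero, pd, mul_comm] using h
  refine ⟨key, fun _ => ?_⟩
  ext k
  simpa [Matrix.mulVec, dotProduct] using key k
end

section
/- Let r ≥ 0 and let x̄₁ < x̄₂ < … < x̄_{r+1} be the r+1 roots of the probabilists' Hermite polynomial He_{r+1} (Mathlib's Polynomial.hermite (r+1)). Then for each j = 1,…,r+1: ∑_{k≠j} 1/(x̄_j − x̄_k) = x̄_j / 2. Consequently the rescaled points q̄_j = x̄_j/√2 satisfy the A_r Calogero equilibrium equations ∑_{k≠j} 1/(q̄_j − q̄_k) = q̄_j for all j. -/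
open Polynomial in
/-- The Hermite polynomials form an Appell sequence. -/
theorem Polynomial.derivative_hermite_succ (n : ℕ) :
    derivative (hermite (n + 1)) = ((n : ℤ[X]) + 1) * hermite n := by
  induction n with
  | zero => simp [hermite_succ]
  | succ n ih =>
    rw [hermite_succ (n + 1), derivative_sub, derivative_mul, derivative_X, ih, derivative_mul]
    simp only [derivative_add, derivative_natCast, derivative_one, hermite_succ n]
    push_cast
    ring

open Polynomial in
/-- The Hermite differential equation. -/
theorem Polynomial.derivative_derivative_hermite (n : ℕ) :
    derivative (derivative (hermite n)) = X * derivative (hermite n) - (n : ℤ[X]) * hermite n := by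
  have h := derivative_hermite_succ n
  rw [hermite_succ, derivative_sub, derivative_mul, derivative_X] at h
  linear_combination -h

open Polynomial in
theorem Lagrange.eval_derivative_nodal_eq {F ι : Type*} [Field F] [DecidableEq ι] (s : Finset ι)
    (v : ι → F) {a : F} (ha : ∀ i ∈ s, a ≠ v i) :
    (derivative (nodal s v)).eval a = (nodal s v).eval a * ∑ i ∈ s, 1 / (a - v i) := by
  rw [derivative_nodal, eval_finsetSum, Finset.mul_sum]
  refine Finset.sum_congr rfl fun i hi => ?_
  rw [nodal_eq_mul_nodal_erase hi, eval_mul, eval_sub, eval_X, eval_C]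
  have := sub_ne_zero.2 (ha i hi)
  field_simp

open Polynomial in
/-- A monic polynomial whose degree is the number of its known distinct roots is their nodal
polynomial. -/
theorem Lagrange.eq_nodal_of_monic {F ι : Type*} [Field F] {s : Finset ι} {v : ι → F}
    (hv : Set.InjOn v s) {p : F[X]} (hp : p.Monic) (hdeg : p.degree = s.card)
    (hroot : ∀ i ∈ s, p.eval (v i) = 0) : p = nodal s v := by
  refine eq_of_degree_le_of_eval_index_eq s hv hdeg.le (by rw [hdeg, degree_nodal]) ?_ ?_
  · rw [hp.leadingCoeff, nodal_monic.leadingCoeff]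
  · exact fun i hi => by rw [hroot i hi, eval_nodal_at_node hi]

open Polynomial in
theorem Polynomial.sum_one_div_sub_eq_of_hermite_roots (n : ℕ) (x : Fin n → ℝ)
    (hx : Function.Injective x) (hroot : ∀ j, aeval (x j) (hermite n) = 0) (j : Fin n) :
    ∑ k ∈ Finset.univ.erase j, 1 / (x j - x k) = x j / 2 := by
  set p : ℝ[X] := (hermite n).map (Int.castRingHom ℝ) with hp
  set q : ℝ[X] := Lagrange.nodal (Finset.univ.erase j) x with hq
  have hpq : p = (X - C (x j)) * q := by
    rw [← Lagrange.nodal_eq_mul_nodal_erase (Finset.mem_univ j)]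
    refine Lagrange.eq_nodal_of_monic hx.injOn ((hermite_monic n).map _) ?_ fun i _ => ?_
    · rw [hp, (hermite_monic n).degree_map, degree_hermite, Finset.card_univ, Fintype.card_fin]
    · rw [hp, eval_map]
      exact hroot i
  have hode : derivative (derivative p) = X * derivative p - (n : ℝ[X]) * p := by
    simpa [hp, derivative_map] using
      congrArg (Polynomial.map (Int.castRingHom ℝ)) (derivative_derivative_hermite n)
  have hne : ∀ k ∈ Finset.univ.erase j, x j ≠ x k :=
    fun k hk => hx.ne (Finset.ne_of_mem_erase hk).symm
  have hq0 : q.eval (x j) ≠ 0 := Lagrange.eval_nodal_not_at_node hne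
  have heval := congrArg (eval (x j)) hode
  rw [hpq] at heval
  simp only [derivative_mul, derivative_add, derivative_sub, derivative_X, derivative_C, eval_add,
    eval_mul, eval_sub, eval_X, eval_C, eval_natCast, sub_self, sub_zero,
    one_mul, zero_mul, add_zero, mul_zero,
    hq, Lagrange.eval_derivative_nodal_eq _ _ hne] at heval
  rw [← hq] at heval
  refine mul_left_cancel₀ hq0 ?_
  linear_combination heval / 2

/-- The zeros `x̄₁ < … < x̄_{r+1}` of the (probabilists') Hermite polynomial `He_{r+1}`
satisfy `∑_{k≠j} 1/(x̄_j − x̄_k) = x̄_j/2`; consequently the rescaled points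
`q̄_j = x̄_j/√2` satisfy the `A_r` Calogero equilibrium equations
`∑_{k≠j} 1/(q̄_j − q̄_k) = q̄_j`. -/
theorem hermite_zeros_calogero_equilibrium (r : ℕ)
    (x : Fin (r+1) → ℝ) (hmono : StrictMono x)
    (hroot : ∀ j, Polynomial.aeval (x j) (Polynomial.hermite (r+1)) = 0) :
    (∀ j, ∑ k ∈ Finset.univ.erase j, 1 / (x j - x k) = x j / 2)
    ∧ (∀ j, ∑ k ∈ Finset.univ.erase j,
        1 / (x j / Real.sqrt 2 - x k / Real.sqrt 2) = x j / Real.sqrt 2) := by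
  have hzero := Polynomial.sum_one_div_sub_eq_of_hermite_roots (r + 1) x hmono.injective hroot
  refine ⟨hzero, fun j => ?_⟩
  have hsqrt : √(2 : ℝ) * √2 = 2 := Real.mul_self_sqrt zero_le_two
  have hscale : ∀ k, 1 / (x j / √2 - x k / √2) = √2 * (1 / (x j - x k)) := fun k => by
    rw [← sub_div, one_div_div, mul_one_div]
  simp_rw [hscale, ← Finset.mul_sum, hzero j]
  field_simp
  linear_combination x j * hsqrt
end

section
/- Let r ≥ 0 and let q₁,…,q_{r+1} be distinct real numbers. Define G(x) = ∏_{j=1}^{r+1} (x + q_j) as a function of x ∈ ℝ. Then for all x ∈ ℝ: −∑_{j=1}^{r+1} ( ∑_{k≠j} 1/(q_j − q_k) ) · ∏_{i≠j} (x + q_i) = (1/2) G''(x), where G'' is the second derivative of G with respect to x. (In operator form: Â_R G = (1/2) ∂_x² G, where Â_R = −∇W_R · ∇ with W_R = ∑_{j<k} log(q_j − q_k).) -/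
theorem deriv_prod_add_const {ι : Type*} [DecidableEq ι] (s : Finset ι) (q : ι → ℝ) :
    deriv (fun y : ℝ => ∏ j ∈ s, (y + q j)) = fun y => ∑ j ∈ s, ∏ i ∈ s.erase j, (y + q i) := by
  funext x
  have h := HasDerivAt.fun_finsetProd (u := s) (f := fun j (y : ℝ) => y + q j) (f' := fun _ => 1)
    (x := x) (fun j _ => (hasDerivAt_id x).add_const (q j))
  simpa using h.deriv

theorem deriv_deriv_prod_add_const {ι : Type*} [DecidableEq ι] (s : Finset ι) (q : ι → ℝ) (x : ℝ) :
    deriv (deriv (fun y : ℝ => ∏ j ∈ s, (y + q j))) x =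
      ∑ j ∈ s, ∑ k ∈ s.erase j, ∏ i ∈ (s.erase j).erase k, (x + q i) := by
  rw [deriv_prod_add_const, deriv_fun_sum fun j _ => by fun_prop]
  exact Finset.sum_congr rfl fun j _ => congrFun (deriv_prod_add_const (s.erase j) q) x

theorem Finset.sum_sum_erase_comm {ι M : Type*} [DecidableEq ι] [AddCommMonoid M] (s : Finset ι)
    (f : ι → ι → M) :
    ∑ j ∈ s, ∑ k ∈ s.erase j, f j k = ∑ j ∈ s, ∑ k ∈ s.erase j, f k j :=
  Finset.sum_comm' fun j k => by simp only [Finset.mem_erase]; tauto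

/-- For distinct `q₁,…,q_{r+1}` and the generating function `G(x) = ∏_j (x + q_j)`,
one has `Â_R G = (1/2) ∂_x² G`, i.e.
`−∑_j (∑_{k≠j} 1/(q_j−q_k)) ∏_{i≠j}(x+q_i) = (1/2) G''(x)`. -/
theorem aR_on_generating_function (r : ℕ) (q : Fin (r+1) → ℝ)
    (hq : Function.Injective q) :
    ∀ x : ℝ,
      -(∑ j, (∑ k ∈ Finset.univ.erase j, 1 / (q j - q k)) *
          ∏ i ∈ Finset.univ.erase j, (x + q i))
        = (1/2) * deriv (deriv (fun y => ∏ j, (y + q j))) x := by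
  intro x
  rw [deriv_deriv_prod_add_const]
  simp only [Finset.sum_mul]
  set a : Fin (r+1) → Fin (r+1) → ℝ := fun j k =>
    1 / (q j - q k) * ∏ i ∈ Finset.univ.erase j, (x + q i) with ha
  have pair : ∀ j, ∀ k ∈ Finset.univ.erase j,
      a j k + a k j = -∏ i ∈ (Finset.univ.erase j).erase k, (x + q i) := by
    intro j k hk
    have hkj : k ≠ j := Finset.ne_of_mem_erase hk
    have h₁ : q j - q k ≠ 0 := sub_ne_zero.2 (hq.ne hkj.symm)
    have h₂ : q k - q j ≠ 0 := sub_ne_zero.2 (hq.ne hkj)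
    have hj : j ∈ Finset.univ.erase k := by simpa using hkj.symm
    simp only [ha]
    rw [← Finset.mul_prod_erase _ _ hk, ← Finset.mul_prod_erase _ _ hj,
      Finset.erase_right_comm (a := k) (b := j), ← neg_sub (q j) (q k)]
    field_simp
    ring
  have sum_pair : ∑ j, ∑ k ∈ Finset.univ.erase j, a j k + ∑ j, ∑ k ∈ Finset.univ.erase j, a k j =
      -∑ j, ∑ k ∈ Finset.univ.erase j, ∏ i ∈ (Finset.univ.erase j).erase k, (x + q i) := by
    simp only [← Finset.sum_add_distrib, ← Finset.sum_neg_distrib]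
    exact Finset.sum_congr rfl fun j _ => Finset.sum_congr rfl (pair j)
  rw [← Finset.sum_sum_erase_comm Finset.univ a] at sum_pair
  change -∑ j, ∑ k ∈ Finset.univ.erase j, a j k = _
  linarith
end

section
/- Let r ≥ 0 and let q₁,…,q_{r+1} be distinct real numbers. For 0 ≤ k ≤ r+1 let e_k denote the degree-k elementary symmetric polynomial in q₁,…,q_{r+1} (with e_k = 0 for k < 0). Then for each k: ∑_{j=1}^{r+1} ( q_j − ∑_{l≠j} 1/(q_j − q_l) ) · ∂e_k/∂q_j = k e_k + ((r+3−k)(r+2−k)/2) e_{k−2}. (In operator form: Â S_k = k S_k + ((r+3−k)(r+2−k)/2) S_{k−2}, where Â = −∇W·∇ with the reduced A_r Calogero prepotential W = ∑_{j<l} log(q_j − q_l) − q²/2.) -/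
/-- The degree-`k` elementary symmetric polynomial of `q₁,…,q_n`. -/
noncomputable def esym {n : ℕ} (k : ℕ) (q : Fin n → ℝ) : ℝ :=
  ∑ t ∈ Finset.univ.powersetCard k, ∏ i ∈ t, q i

/-- The degree-`k` elementary symmetric polynomial in the variables `q i` with `i ∈ s`. -/
def esymOn {ι R : Type*} [CommRing R] (s : Finset ι) (k : ℕ) (q : ι → R) : R :=
  ∑ t ∈ s.powersetCard k, ∏ i ∈ t, q i

section esymOn

variable {ι R : Type*} [CommRing R]

@[simp]
lemma esymOn_zero (s : Finset ι) (q : ι → R) : esymOn s 0 q = 1 := by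
  simp [esymOn]

variable [DecidableEq ι]

lemma esymOn_succ_eq_erase_add {s : Finset ι} {a : ι} (ha : a ∈ s) (k : ℕ) (q : ι → R) :
    esymOn s (k + 1) q = esymOn (s.erase a) (k + 1) q + q a * esymOn (s.erase a) k q := by
  have hs := Finset.notMem_erase a s
  unfold esymOn
  conv_lhs => rw [← Finset.insert_erase ha]
  rw [Finset.powersetCard_succ_insert hs, Finset.sum_union, Finset.sum_image, Finset.mul_sum]
  · congr 1
    refine Finset.sum_congr rfl fun t ht => ?_
    exact Finset.prod_insert fun h => hs ((Finset.mem_powersetCard.1 ht).1 h)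
  · intro t ht u hu h
    have ht' : a ∉ t := fun h => hs ((Finset.mem_powersetCard.1 ht).1 h)
    have hu' : a ∉ u := fun h => hs ((Finset.mem_powersetCard.1 hu).1 h)
    rw [← Finset.erase_insert ht', ← Finset.erase_insert hu', h]
  · rw [Finset.disjoint_left]
    intro t ht hu
    obtain ⟨u, -, rfl⟩ := Finset.mem_image.1 hu
    exact hs ((Finset.mem_powersetCard.1 ht).1 (Finset.mem_insert_self a u))

lemma sum_esymOn_erase (s : Finset ι) (k : ℕ) (q : ι → R) :
    ∑ a ∈ s, esymOn (s.erase a) k q = ((s.card : R) - k) * esymOn s k q := by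
  unfold esymOn
  rw [Finset.sum_comm' (t' := s.powersetCard k) (s' := fun t => s \ t), Finset.mul_sum]
  · refine Finset.sum_congr rfl fun t ht => ?_
    obtain ⟨hts, rfl⟩ := Finset.mem_powersetCard.1 ht
    rw [Finset.sum_const, nsmul_eq_mul, Finset.card_sdiff_of_subset hts,
      Nat.cast_sub (Finset.card_le_card hts)]
  · intro a t
    simp only [Finset.mem_powersetCard, Finset.subset_erase, Finset.mem_sdiff]
    tauto

lemma sum_mul_esymOn_erase (s : Finset ι) (k : ℕ) (q : ι → R) :
    ∑ a ∈ s, q a * esymOn (s.erase a) k q = ((k + 1 : ℕ) : R) * esymOn s (k + 1) q := by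
  have h : ∀ a ∈ s, q a * esymOn (s.erase a) k q
      = esymOn s (k + 1) q - esymOn (s.erase a) (k + 1) q := fun a ha => by
    rw [esymOn_succ_eq_erase_add ha]; ring
  rw [Finset.sum_congr rfl h, Finset.sum_sub_distrib, sum_esymOn_erase, Finset.sum_const,
    nsmul_eq_mul]
  ring

lemma sum_sum_esymOn_erase_erase (s : Finset ι) (k : ℕ) (q : ι → R) :
    ∑ a ∈ s, ∑ b ∈ s.erase a, esymOn ((s.erase a).erase b) k q
      = ((s.card : R) - k) * ((s.card : R) - 1 - k) * esymOn s k q := by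
  have h : ∀ a ∈ s, ∑ b ∈ s.erase a, esymOn ((s.erase a).erase b) k q
      = ((s.card : R) - 1 - k) * esymOn (s.erase a) k q := fun a ha => by
    rw [sum_esymOn_erase, Finset.card_erase_of_mem ha, Nat.cast_sub (Finset.card_pos.2 ⟨a, ha⟩),
      Nat.cast_one]
  rw [Finset.sum_congr rfl h, ← Finset.mul_sum, sum_esymOn_erase]
  ring

lemma esymOn_erase_sub_esymOn_erase {s : Finset ι} {a b : ι} (ha : a ∈ s) (hb : b ∈ s)
    (hab : a ≠ b) (k : ℕ) (q : ι → R) :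
    esymOn (s.erase a) (k + 1) q - esymOn (s.erase b) (k + 1) q
      = (q b - q a) * esymOn ((s.erase a).erase b) k q := by
  rw [esymOn_succ_eq_erase_add (Finset.mem_erase.2 ⟨hab.symm, hb⟩),
    esymOn_succ_eq_erase_add (Finset.mem_erase.2 ⟨hab, ha⟩), Finset.erase_right_comm (a := b)]
  ring

lemma esymOn_add_single_of_notMem {s : Finset ι} {a : ι} (ha : a ∉ s) (k : ℕ) (q : ι → R)
    (x : R) : esymOn s k (q + Pi.single a x) = esymOn s k q := by
  refine Finset.sum_congr rfl fun t ht => Finset.prod_congr rfl fun i hi => ?_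
  have hia : i ≠ a := fun h => ha (h ▸ (Finset.mem_powersetCard.1 ht).1 hi)
  simp [hia]

end esymOn

lemma two_mul_sum_sum_erase_one_div_mul {ι K : Type*} [DecidableEq ι] [Field K] (s : Finset ι)
    (q f : ι → K) :
    2 * ∑ a ∈ s, ∑ b ∈ s.erase a, 1 / (q a - q b) * f a
      = ∑ a ∈ s, ∑ b ∈ s.erase a, (f a - f b) / (q a - q b) := by
  have hswap : ∑ a ∈ s, ∑ b ∈ s.erase a, 1 / (q a - q b) * f a
      = ∑ a ∈ s, ∑ b ∈ s.erase a, 1 / (q b - q a) * f b :=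
    Finset.sum_comm' fun a b => by simp only [Finset.mem_erase]; tauto
  rw [two_mul]
  nth_rewrite 2 [hswap]
  simp only [← Finset.sum_add_distrib]
  refine Finset.sum_congr rfl fun a _ => Finset.sum_congr rfl fun b _ => ?_
  rw [← neg_sub (q a) (q b), one_div_neg_eq_neg_one_div]
  ring

lemma two_mul_sum_sum_erase_one_div_mul_esymOn {ι K : Type*} [DecidableEq ι] [Field K]
    {q : ι → K} (hq : Function.Injective q) (s : Finset ι) (k : ℕ) :
    2 * ∑ a ∈ s, ∑ b ∈ s.erase a, 1 / (q a - q b) * esymOn (s.erase a) (k + 1) q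
      = -(((s.card : K) - k) * ((s.card : K) - 1 - k) * esymOn s k q) := by
  rw [two_mul_sum_sum_erase_one_div_mul s q fun a => esymOn (s.erase a) (k + 1) q,
    ← sum_sum_esymOn_erase_erase, ← Finset.sum_neg_distrib]
  refine Finset.sum_congr rfl fun a ha => ?_
  rw [← Finset.sum_neg_distrib]
  refine Finset.sum_congr rfl fun b hb => ?_
  obtain ⟨hba, hb⟩ := Finset.mem_erase.1 hb
  have hne : q a - q b ≠ 0 := sub_ne_zero.2 (hq.ne hba.symm)
  rw [esymOn_erase_sub_esymOn_erase ha hb hba.symm, div_eq_iff hne]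
  ring

lemma pd_esym_zero {n : ℕ} (j : Fin n) (q : Fin n → ℝ) : pd (esym 0) j q = 0 := by
  have h : (esym 0 : (Fin n → ℝ) → ℝ) = fun _ => 1 := by
    funext q
    exact esymOn_zero _ q
  simp [pd, h]

lemma pd_esym_succ {n : ℕ} (k : ℕ) (j : Fin n) (q : Fin n → ℝ) :
    pd (esym (k + 1)) j q = esymOn (Finset.univ.erase j) k q := by
  have hd : DifferentiableAt ℝ (esym (k + 1) : (Fin n → ℝ) → ℝ) q := by
    unfold esym
    fun_prop
  have hline : ∀ x : ℝ, esym (k + 1) (q + x • Pi.single j 1)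
      = esymOn (Finset.univ.erase j) (k + 1) q
        + (q j + x) * esymOn (Finset.univ.erase j) k q := fun x => by
    have hs := Finset.notMem_erase j (Finset.univ : Finset (Fin n))
    rw [← Pi.single_smul, smul_eq_mul, mul_one]
    refine (esymOn_succ_eq_erase_add (Finset.mem_univ j) k _).trans ?_
    rw [esymOn_add_single_of_notMem hs, esymOn_add_single_of_notMem hs]
    simp
  rw [pd, ← hd.lineDeriv_eq_fderiv, lineDeriv]
  simp only [hline]
  simp

/-- Action of the reduced `A_r` Calogero operator `Â = −∇W·∇`,
`W = ∑_{j<l} log(q_j−q_l) − q²/2`, on the elementary symmetric polynomials: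
`Â S_k = k S_k + (r+3−k)(r+2−k)/2 · S_{k−2}` (with `S_{k−2} = 0` for `k < 2`). -/
theorem a_on_esym_A (r : ℕ) (q : Fin (r+1) → ℝ) (hq : Function.Injective q)
    (k : ℕ) (hk : k ≤ r + 1) :
    ∑ j, (q j - ∑ l ∈ Finset.univ.erase j, 1 / (q j - q l)) * pd (esym k) j q
      = (k : ℝ) * esym k q
        + (((r : ℝ) + 3 - k) * ((r : ℝ) + 2 - k) / 2) *
            (if 2 ≤ k then esym (k - 2) q else 0) := by
  obtain _ | k := k
  · simp [pd_esym_zero]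
  have hdiag := sum_mul_esymOn_erase Finset.univ k q
  have hesym : ∀ m, esym m q = esymOn Finset.univ m q := fun _ => rfl
  simp only [pd_esym_succ, sub_mul, Finset.sum_sub_distrib, Finset.sum_mul, hdiag, hesym]
  obtain _ | k := k
  · have hpair := two_mul_sum_sum_erase_one_div_mul Finset.univ q fun _ => 1
    simp only [sub_self, zero_div, Finset.sum_const_zero] at hpair
    simp only [esymOn_zero]
    norm_num at hpair ⊢
    exact hpair
  · have hpair := two_mul_sum_sum_erase_one_div_mul_esymOn hq Finset.univ k
    rw [Finset.card_univ, Fintype.card_fin] at hpair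
    rw [if_pos (by omega), show k + 1 + 1 - 2 = k by omega]
    push_cast at hpair ⊢
    linear_combination -hpair / 2
end

section
/- Let r ≥ 1, γ ∈ ℝ, and let q ∈ ℝ^r have nonzero coordinates with q₁²,…,q_r² pairwise distinct. Define G(x) = ∏_{j=1}^r (x + q_j²) for x ∈ ℝ. Then for all x ∈ ℝ: (i) −∑_{j=1}^r ( ∑_{k≠j} 2q_j/(q_j² − q_k²) + γ/q_j ) · ∂G/∂q_j = −2x G''(x) − 2γ G'(x), and (ii) ∑_{j=1}^r ∂²G/∂q_j² = 2 G'(x), where ∂G/∂q_j = 2q_j ∏_{i≠j}(x + q_i²) and primes denote x-derivatives. (In operator form: Â_R G = −2x∂_x²G − 2γ∂_xG and ΔG = 2∂_xG for the B_r rational prepotential.) -/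
theorem hasFDerivAt_prod_add_sq {ι : Type*} [Fintype ι] [DecidableEq ι] (x : ℝ) (s : Finset ι)
    (p : ι → ℝ) :
    HasFDerivAt (fun p : ι → ℝ => ∏ i ∈ s, (x + (p i) ^ 2))
      (∑ i ∈ s, (∏ k ∈ s.erase i, (x + (p k) ^ 2)) •
        ((2 * p i) • (ContinuousLinearMap.proj i : (ι → ℝ) →L[ℝ] ℝ))) p := by
  refine HasFDerivAt.finsetProd fun i _ => ?_
  have h := ((hasFDerivAt_apply (𝕜 := ℝ) (F' := fun _ : ι => ℝ) i p).pow 2).const_add x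
  simpa using h

theorem pd_prod_add_sq {r : ℕ} (x : ℝ) (j : Fin r) (p : Fin r → ℝ) :
    pd (fun p => ∏ i, (x + (p i) ^ 2)) j p =
      2 * p j * ∏ i ∈ Finset.univ.erase j, (x + (p i) ^ 2) := by
  rw [pd, (hasFDerivAt_prod_add_sq x Finset.univ p).fderiv]
  simp [Pi.single_apply, mul_comm]

theorem pd_pd_prod_add_sq {r : ℕ} (x : ℝ) (j : Fin r) (p : Fin r → ℝ) :
    pd (pd (fun p => ∏ i, (x + (p i) ^ 2)) j) j p =
      2 * ∏ i ∈ Finset.univ.erase j, (x + (p i) ^ 2) := by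
  have h : pd (fun p : Fin r → ℝ => ∏ i, (x + (p i) ^ 2)) j =
      fun p => 2 * p j * ∏ i ∈ Finset.univ.erase j, (x + (p i) ^ 2) :=
    funext fun p => pd_prod_add_sq x j p
  have h₁ := (hasFDerivAt_apply (𝕜 := ℝ) (F' := fun _ : Fin r => ℝ) j p).const_mul (2 : ℝ)
  rw [h, pd, (h₁.fun_mul (hasFDerivAt_prod_add_sq x (Finset.univ.erase j) p)).fderiv]
  simp [Pi.single_apply, mul_comm]

theorem hasDerivAt_prod_add {ι : Type*} [DecidableEq ι] (u : ι → ℝ) (s : Finset ι) (x : ℝ) :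
    HasDerivAt (fun y => ∏ i ∈ s, (y + u i)) (∑ i ∈ s, ∏ k ∈ s.erase i, (x + u k)) x := by
  simpa using HasDerivAt.fun_finsetProd (u := s) (f := fun i y => y + u i) (f' := fun _ => 1)
    fun i _ => (hasDerivAt_id x).add_const (u i)

theorem deriv_prod_add {ι : Type*} [DecidableEq ι] (u : ι → ℝ) (s : Finset ι) :
    deriv (fun y => ∏ i ∈ s, (y + u i)) = fun x => ∑ i ∈ s, ∏ k ∈ s.erase i, (x + u k) :=
  funext fun x => (hasDerivAt_prod_add u s x).deriv

theorem deriv_deriv_prod_add {ι : Type*} [DecidableEq ι] (u : ι → ℝ) (s : Finset ι) (x : ℝ) :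
    deriv (deriv (fun y => ∏ i ∈ s, (y + u i))) x =
      ∑ i ∈ s, ∑ k ∈ s.erase i, ∏ l ∈ (s.erase i).erase k, (x + u l) := by
  rw [deriv_prod_add]
  exact (HasDerivAt.fun_sum fun i _ => hasDerivAt_prod_add u (s.erase i) x).deriv

/-- Swapping the two indices and averaging removes the poles at `u j = u k`. -/
theorem sum_sum_div_sub_mul_prod {ι : Type*} [DecidableEq ι] (u : ι → ℝ)
    (hu : Function.Injective u) (s : Finset ι) (x : ℝ) :
    2 * ∑ j ∈ s, ∑ k ∈ s.erase j, u j / (u j - u k) * ∏ i ∈ s.erase j, (x + u i) =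
      x * ∑ j ∈ s, ∑ k ∈ s.erase j, ∏ l ∈ (s.erase j).erase k, (x + u l) := by
  have hswap : ∑ j ∈ s, ∑ k ∈ s.erase j, u j / (u j - u k) * ∏ i ∈ s.erase j, (x + u i) =
      ∑ j ∈ s, ∑ k ∈ s.erase j, u k / (u k - u j) * ∏ i ∈ s.erase k, (x + u i) :=
    Finset.sum_comm' fun j k => by simp only [Finset.mem_erase]; tauto
  rw [two_mul]
  nth_rewrite 2 [hswap]
  rw [← Finset.sum_add_distrib, Finset.mul_sum]
  refine Finset.sum_congr rfl fun j hj => ?_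
  rw [← Finset.sum_add_distrib, Finset.mul_sum]
  refine Finset.sum_congr rfl fun k hk => ?_
  have hkj : k ≠ j := Finset.ne_of_mem_erase hk
  have hj' : j ∈ s.erase k := Finset.mem_erase.2 ⟨hkj.symm, hj⟩
  rw [← Finset.mul_prod_erase _ _ hk, ← Finset.mul_prod_erase _ _ hj',
    Finset.erase_right_comm (a := k)]
  have h₁ : u j - u k ≠ 0 := sub_ne_zero.2 (hu.ne hkj.symm)
  have h₂ : u k - u j ≠ 0 := sub_ne_zero.2 (hu.ne hkj)
  rw [← neg_sub (u j) (u k)]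
  field_simp
  ring

/-- For the `B_r` rational prepotential, the generating function
`G(x) = ∏_j (x + q_j²)` satisfies `Â_R G = −2x ∂_x²G − 2γ ∂_xG` and `ΔG = 2∂_xG`. -/
theorem B_series_generating_function (r : ℕ) (hr : 1 ≤ r) (γ : ℝ)
    (q : Fin r → ℝ) (hq0 : ∀ j, q j ≠ 0)
    (hqd : Function.Injective fun j => (q j)^2) :
    ∀ x : ℝ,
      (-(∑ j, (∑ k ∈ Finset.univ.erase j, 2 * q j / ((q j)^2 - (q k)^2) + γ / q j) *
            pd (fun p => ∏ i, (x + (p i)^2)) j q)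
        = -2 * x * deriv (deriv (fun y => ∏ i, (y + (q i)^2))) x
            - 2 * γ * deriv (fun y => ∏ i, (y + (q i)^2)) x)
      ∧ (∑ j, pd (pd (fun p => ∏ i, (x + (p i)^2)) j) j q
          = 2 * deriv (fun y => ∏ i, (y + (q i)^2)) x) := by
  intro x
  have h₁ := congrFun (deriv_prod_add (fun i => (q i) ^ 2) Finset.univ) x
  have h₂ := deriv_deriv_prod_add (fun i => (q i) ^ 2) Finset.univ x
  refine ⟨?_, ?_⟩
  · have key := sum_sum_div_sub_mul_prod (fun i => (q i) ^ 2) hqd Finset.univ x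
    have hterm : ∀ j, (∑ k ∈ Finset.univ.erase j, 2 * q j / ((q j)^2 - (q k)^2) + γ / q j) *
        pd (fun p => ∏ i, (x + (p i)^2)) j q =
        4 * (∑ k ∈ Finset.univ.erase j, (q j)^2 / ((q j)^2 - (q k)^2) *
          ∏ i ∈ Finset.univ.erase j, (x + (q i)^2)) +
        2 * γ * ∏ i ∈ Finset.univ.erase j, (x + (q i)^2) := fun j => by
      rw [pd_prod_add_sq, add_mul, Finset.sum_mul, Finset.mul_sum]
      congr 1
      · exact Finset.sum_congr rfl fun k _ => by ring
      · have := hq0 j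
        field_simp
    rw [h₁, h₂, Finset.sum_congr rfl fun j _ => hterm j, Finset.sum_add_distrib,
      ← Finset.mul_sum, ← Finset.mul_sum]
    linear_combination -2 * key
  · rw [h₁, Finset.mul_sum]
    exact Finset.sum_congr rfl fun j _ => pd_pd_prod_add_sq x j q
end

section
/- Let r ≥ 1, let Δ₊ be a finite set of nonzero vectors in ℝ^r with real couplings g_ρ, let ω > 0, ℏ > 0, n ∈ ℕ, and set s = ∑_{ρ∈Δ₊} g_ρ, α = r/2 + s/ℏ − 1. Define the associated Laguerre polynomial L_n^{(α)}(x) = ∑_{j=0}^n (−1)^j ( ∏_{m=j+1}^{n} (α+m) / (n−j)! ) x^j / j!, and let W(q) = ∑_{ρ∈Δ₊} g_ρ log(ρ·q) − (ω/2) q². Then the function φ(q) = L_n^{(α)}(ω q² / ℏ) satisfies, at every point q with ρ·q ≠ 0 for all ρ ∈ Δ₊, the eigenvalue equation −(ℏ²/2) Δφ(q) − ℏ ∑_{j=1}^r ∂W/∂q_j(q) ∂φ/∂q_j(q) = 2nωℏ φ(q). -/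
open Polynomial in
/-- The associated Laguerre polynomial `L_n^{(α)}`. -/
noncomputable def laguerrePoly (α : ℝ) (n : ℕ) : ℝ[X] :=
  ∑ j ∈ Finset.range (n + 1),
    C ((-1 : ℝ)^j * ((∏ m ∈ Finset.Icc (j+1) n, (α + m)) / ((n - j).factorial : ℝ))
      / (j.factorial : ℝ)) * X ^ j

theorem laguerrePoly_coeff (α : ℝ) (n k : ℕ) :
    (laguerrePoly α n).coeff k = if k ≤ n then
      (-1 : ℝ)^k * ((∏ m ∈ Finset.Icc (k+1) n, (α + m)) / ((n - k).factorial : ℝ))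
        / (k.factorial : ℝ) else 0 := by
  simp [laguerrePoly, Polynomial.finsetSum_coeff, Polynomial.coeff_C_mul, Polynomial.coeff_X_pow]

theorem laguerrePoly_coeff_succ (α : ℝ) (n k : ℕ) :
    ((k : ℝ) + 1) * (α + k + 1) * (laguerrePoly α n).coeff (k + 1)
      = -((n : ℝ) - k) * (laguerrePoly α n).coeff k := by
  rw [laguerrePoly_coeff, laguerrePoly_coeff]
  rcases lt_trichotomy k n with h | rfl | h
  · obtain ⟨d, rfl⟩ : ∃ d, n = k + 1 + d := ⟨n - (k + 1), by omega⟩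
    rw [if_pos (by omega), if_pos (by omega),
      ← Finset.mul_prod_Ioc_eq_prod_Icc (a := k + 1) (by omega),
      ← Finset.Icc_add_one_left_eq_Ioc, show k + 1 + d - k = d + 1 by omega,
      show k + 1 + d - (k + 1) = d by omega, Nat.factorial_succ, Nat.factorial_succ, pow_succ]
    push_cast
    field_simp
    ring
  · simp
  · rw [if_neg (by omega), if_neg (by omega)]
    simp

open Polynomial in
/-- Laguerre's differential equation. -/
theorem laguerrePoly_ode (α : ℝ) (n : ℕ) :
    X * derivative (derivative (laguerrePoly α n))
      + (C (α + 1) - X) * derivative (laguerrePoly α n) + C (n : ℝ) * laguerrePoly α n = 0 := by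
  ext k
  cases k with
  | zero =>
    have h := laguerrePoly_coeff_succ α n 0
    simp only [coeff_add, sub_mul, coeff_sub, coeff_C_mul, coeff_X_mul_zero, coeff_derivative,
      coeff_zero]
    push_cast at h ⊢
    linear_combination h
  | succ k =>
    have h := laguerrePoly_coeff_succ α n (k + 1)
    simp only [coeff_add, sub_mul, coeff_sub, coeff_C_mul, coeff_X_mul, coeff_derivative,
      coeff_zero]
    push_cast at h ⊢
    linear_combination h

theorem HasFDerivAt.pd_eq {r : ℕ} {f : (Fin r → ℝ) → ℝ} {f' : (Fin r → ℝ) →L[ℝ] ℝ}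
    {q : Fin r → ℝ} (h : HasFDerivAt f f' q) (j : Fin r) : pd f j q = f' (Pi.single j 1) := by
  rw [pd, h.fderiv]

theorem hasFDerivAt_linear_form {r : ℕ} (ρ q : Fin r → ℝ) :
    HasFDerivAt (fun p : Fin r → ℝ => ∑ i, ρ i * p i)
      (∑ i, ρ i • (ContinuousLinearMap.proj i : (Fin r → ℝ) →L[ℝ] ℝ)) q :=
  HasFDerivAt.fun_sum fun i _ => (hasFDerivAt_apply i q).const_mul (ρ i)

theorem hasFDerivAt_sum_sq {r : ℕ} (q : Fin r → ℝ) :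
    HasFDerivAt (fun p : Fin r → ℝ => ∑ i, (p i) ^ 2)
      (∑ i, (2 * q i) • (ContinuousLinearMap.proj i : (Fin r → ℝ) →L[ℝ] ℝ)) q := by
  refine HasFDerivAt.fun_sum fun i _ => ?_
  simpa using (hasFDerivAt_apply (𝕜 := ℝ) i q).pow 2

theorem sum_smul_proj_single {r : ℕ} (v : Fin r → ℝ) (j : Fin r) :
    (∑ i, v i • (ContinuousLinearMap.proj i : (Fin r → ℝ) →L[ℝ] ℝ)) (Pi.single j 1) = v j := by
  simp [Pi.single_apply]

theorem hasFDerivAt_eval_radial {r : ℕ} (P : Polynomial ℝ) (ω ℏ : ℝ) (q : Fin r → ℝ) :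
    HasFDerivAt (fun p : Fin r → ℝ => P.eval (ω * (∑ i, (p i) ^ 2) / ℏ))
      (P.derivative.eval (ω * (∑ i, (q i) ^ 2) / ℏ) • (ω / ℏ) •
        ∑ i, (2 * q i) • (ContinuousLinearMap.proj i : (Fin r → ℝ) →L[ℝ] ℝ)) q := by
  have h : HasFDerivAt (fun p : Fin r → ℝ => ω * (∑ i, (p i) ^ 2) / ℏ)
      ((ω / ℏ) • ∑ i, (2 * q i) • (ContinuousLinearMap.proj i : (Fin r → ℝ) →L[ℝ] ℝ)) q := by
    simpa only [mul_div_right_comm] using (hasFDerivAt_sum_sq q).const_mul (ω / ℏ)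
  exact (P.hasDerivAt _).comp_hasFDerivAt q h

theorem pd_eval_radial {r : ℕ} (P : Polynomial ℝ) (ω ℏ : ℝ) (j : Fin r) (q : Fin r → ℝ) :
    pd (fun p : Fin r → ℝ => P.eval (ω * (∑ i, (p i) ^ 2) / ℏ)) j q
      = P.derivative.eval (ω * (∑ i, (q i) ^ 2) / ℏ) * (2 * ω / ℏ * q j) := by
  rw [(hasFDerivAt_eval_radial P ω ℏ q).pd_eq, smul_apply,
    smul_apply, sum_smul_proj_single (fun i => 2 * q i), smul_eq_mul,
    smul_eq_mul]
  ring

theorem pd_pd_eval_radial {r : ℕ} (P : Polynomial ℝ) (ω ℏ : ℝ) (j : Fin r) (q : Fin r → ℝ) :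
    pd (pd (fun p : Fin r → ℝ => P.eval (ω * (∑ i, (p i) ^ 2) / ℏ)) j) j q
      = P.derivative.derivative.eval (ω * (∑ i, (q i) ^ 2) / ℏ) * (2 * ω / ℏ) ^ 2 * (q j) ^ 2
        + P.derivative.eval (ω * (∑ i, (q i) ^ 2) / ℏ) * (2 * ω / ℏ) := by
  rw [funext (pd_eval_radial P ω ℏ j),
    ((hasFDerivAt_eval_radial P.derivative ω ℏ q).fun_mul
      ((hasFDerivAt_apply (𝕜 := ℝ) j q).const_mul (2 * ω / ℏ))).pd_eq]
  simp only [add_apply, smul_apply,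
    sum_smul_proj_single (fun i => 2 * q i), smul_eq_mul, ContinuousLinearMap.proj_apply,
    Pi.single_eq_same]
  ring

theorem pd_prepotential {r : ℕ} (Δp : Finset (Fin r → ℝ)) (g : (Fin r → ℝ) → ℝ) (ω : ℝ)
    (q : Fin r → ℝ) (hq : ∀ ρ ∈ Δp, (∑ i, ρ i * q i) ≠ 0) (j : Fin r) :
    pd (fun p => (∑ ρ ∈ Δp, g ρ * Real.log (∑ i, ρ i * p i)) - ω / 2 * (∑ i, (p i) ^ 2)) j q
      = (∑ ρ ∈ Δp, g ρ * (ρ j / ∑ i, ρ i * q i)) - ω * q j := by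
  rw [((HasFDerivAt.fun_sum fun ρ hρ =>
      ((hasFDerivAt_linear_form ρ q).log (hq ρ hρ)).const_mul (g ρ)).fun_sub
    ((hasFDerivAt_sum_sq q).const_mul (ω / 2))).pd_eq]
  simp only [sub_apply, smul_apply,
    sum_smul_proj_single (fun i => 2 * q i), smul_eq_mul]
  rw [sum_apply]
  simp only [smul_apply, sum_smul_proj_single, smul_eq_mul]
  congr 1
  · exact Finset.sum_congr rfl fun ρ _ => by ring
  · ring

/-- Euler's identity for the prepotential: `q · ∇W = ∑ g_ρ - ω q²`. -/
theorem sum_pd_prepotential_mul {r : ℕ} (Δp : Finset (Fin r → ℝ)) (g : (Fin r → ℝ) → ℝ) (ω : ℝ)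
    (q : Fin r → ℝ) (hq : ∀ ρ ∈ Δp, (∑ i, ρ i * q i) ≠ 0) :
    ∑ j, pd (fun p => (∑ ρ ∈ Δp, g ρ * Real.log (∑ i, ρ i * p i))
        - ω / 2 * (∑ i, (p i) ^ 2)) j q * q j
      = (∑ ρ ∈ Δp, g ρ) - ω * ∑ i, (q i) ^ 2 := by
  simp only [pd_prepotential Δp g ω q hq, sub_mul, Finset.sum_sub_distrib, Finset.sum_mul]
  rw [Finset.sum_comm, Finset.mul_sum]
  congr 1
  · refine Finset.sum_congr rfl fun ρ hρ => ?_
    calc ∑ j, g ρ * (ρ j / ∑ i, ρ i * q i) * q j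
        = g ρ * ((∑ j, ρ j * q j) / ∑ i, ρ i * q i) := by
          rw [Finset.sum_div, Finset.mul_sum]
          exact Finset.sum_congr rfl fun j _ => by ring
      _ = g ρ := by rw [div_self (hq ρ hρ), mul_one]
  · exact Finset.sum_congr rfl fun j _ => by ring

/-- The radial (Laguerre) quantum eigenfunctions of a Calogero system based on any set
of positive roots `Δ₊`: `φ(q) = L_n^{(α)}(ωq²/ℏ)` with `α = r/2 + (∑g_ρ)/ℏ − 1`
satisfies `Ĥ φ = 2nωℏ φ`. -/
theorem laguerre_quantum_eigenfunction (r : ℕ) (hr : 1 ≤ r)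
    (Δp : Finset (Fin r → ℝ)) (hΔp : ∀ ρ ∈ Δp, ρ ≠ 0)
    (g : (Fin r → ℝ) → ℝ) (ω ℏ : ℝ) (hω : 0 < ω) (hℏ : 0 < ℏ) (n : ℕ)
    (s α : ℝ) (hs : s = ∑ ρ ∈ Δp, g ρ) (hα : α = (r : ℝ)/2 + s/ℏ - 1)
    (L : ℝ → ℝ)
    (hL : ∀ x, L x = ∑ j ∈ Finset.range (n + 1),
        (-1 : ℝ)^j * ((∏ m ∈ Finset.Icc (j+1) n, (α + m)) / ((n - j).factorial : ℝ))
          * x^j / (j.factorial : ℝ))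
    (W : (Fin r → ℝ) → ℝ)
    (hW : ∀ q, W q = (∑ ρ ∈ Δp, g ρ * Real.log (∑ i, ρ i * q i))
        - ω/2 * (∑ i, (q i)^2)) :
    ∀ q : Fin r → ℝ, (∀ ρ ∈ Δp, (∑ i, ρ i * q i) ≠ 0) →
      -(ℏ^2/2) * (∑ j, pd (pd (fun p => L (ω * (∑ i, (p i)^2) / ℏ)) j) j q)
        - ℏ * (∑ j, pd W j q * pd (fun p => L (ω * (∑ i, (p i)^2) / ℏ)) j q)
      = 2 * (n : ℝ) * ω * ℏ * L (ω * (∑ i, (q i)^2) / ℏ) := by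
  intro q hq
  obtain rfl : L = fun x => (laguerrePoly α n).eval x := by
    funext x
    rw [hL, laguerrePoly, Polynomial.eval_finsetSum]
    refine Finset.sum_congr rfl fun j _ => ?_
    simp only [Polynomial.eval_mul, Polynomial.eval_C, Polynomial.eval_pow, Polynomial.eval_X]
    ring
  obtain rfl := funext hW
  have hode := congrArg (Polynomial.eval (ω * (∑ i, (q i) ^ 2) / ℏ)) (laguerrePoly_ode α n)
  have hE := sum_pd_prepotential_mul Δp g ω q hq
  rw [← hs] at hE
  simp only [Polynomial.eval_add, Polynomial.eval_mul, Polynomial.eval_sub, Polynomial.eval_X,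
    Polynomial.eval_C, Polynomial.eval_zero] at hode
  simp only [pd_pd_eval_radial, pd_eval_radial]
  rw [Finset.sum_add_distrib, ← Finset.mul_sum, Finset.sum_const, Finset.card_univ,
    Fintype.card_fin, nsmul_eq_mul]
  have hcross (D : ℝ) (w : Fin r → ℝ) :
      ∑ j, w j * (D * (2 * ω / ℏ * q j)) = D * (2 * ω / ℏ) * ∑ j, w j * q j := by
    rw [Finset.mul_sum]
    exact Finset.sum_congr rfl fun j _ => by ring
  rw [hcross, hE]
  generalize (laguerrePoly α n).derivative.derivative.eval _ = A at *
  generalize (laguerrePoly α n).derivative.eval _ = B at *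
  generalize (laguerrePoly α n).eval _ = D at *
  generalize ∑ i, (q i) ^ 2 = Q at *
  rw [hα] at hode
  field_simp at hode ⊢
  linear_combination -hode
end

section
/- Let r ≥ 1, s > 0, ω > 0, n ∈ ℕ, and fix q ∈ ℝ^r. For ℏ > 0 set α(ℏ) = r/2 + s/ℏ − 1 and L_n^{(α)}(x) = ∑_{j=0}^n (−1)^j ( ∏_{m=j+1}^{n} (α+m) / (n−j)! ) x^j / j!. Then lim_{ℏ→0⁺} ℏ^n L_n^{(α(ℏ))}( ω q² / ℏ ) = (−1)^n (ω^n / n!) ( q² − q̄² )^n, where q̄² = s/ω. That is, the classical limit of the normalised Laguerre quantum eigenfunction of the Calogero system is (−1)^n ω^n (q² − q̄²)^n / n!, which vanishes at the classical equilibrium radius ω q̄² = ∑_{ρ∈Δ₊} g_ρ. -/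
/-- A factor `ℏⁿ` clears the poles at `ℏ = 0` of the degree-`j` term of a Laguerre polynomial with
parameter `c + s / ℏ` and argument `x / ℏ`. -/
lemma pow_mul_laguerre_term {ℏ : ℝ} (hℏ : ℏ ≠ 0) (c s x : ℝ) {j n : ℕ} (hj : j ≤ n) :
    ℏ ^ n * ((∏ m ∈ Finset.Icc (j + 1) n, (c + s / ℏ - 1 + m)) * (x / ℏ) ^ j) =
      (∏ m ∈ Finset.Icc (j + 1) n, (ℏ * (c - 1 + m) + s)) * x ^ j := by
  have hprod : ∏ m ∈ Finset.Icc (j + 1) n, (ℏ * (c - 1 + m) + s) =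
      ℏ ^ (n - j) * ∏ m ∈ Finset.Icc (j + 1) n, (c + s / ℏ - 1 + m) := by
    have hcard : n - j = (Finset.Icc (j + 1) n).card := by simp
    rw [hcard, ← Finset.prod_const, ← Finset.prod_mul_distrib]
    refine Finset.prod_congr rfl fun m _ => ?_
    field_simp
    ring
  rw [hprod, div_pow, ← pow_sub_mul_pow ℏ hj]
  field_simp

/-- The binomial theorem for `(s - x)ⁿ / n!`, with the binomial coefficients written through
factorials. -/
lemma sum_neg_one_pow_mul_div_factorial (s x : ℝ) (n : ℕ) :
    ∑ j ∈ Finset.range (n + 1),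
      (-1 : ℝ) ^ j * (s ^ (n - j) / ((n - j).factorial : ℝ)) * x ^ j / (j.factorial : ℝ) =
      (s - x) ^ n / (n.factorial : ℝ) := by
  rw [show s - x = -x + s by ring, add_pow, Finset.sum_div]
  refine Finset.sum_congr rfl fun j hj => ?_
  rw [Nat.cast_choose ℝ (Finset.mem_range_succ_iff.mp hj), neg_pow x]
  field_simp

/-- The classical limit `ℏ → 0⁺` of the normalised Laguerre quantum eigenfunction
`ℏⁿ L_n^{(α(ℏ))}(ωq²/ℏ)`, `α(ℏ) = r/2 + s/ℏ − 1`, of the Calogero system is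
`(−1)ⁿ ωⁿ (q² − q̄²)ⁿ/n!` with the classical equilibrium radius `q̄² = s/ω`. -/
theorem laguerre_classical_limit (r : ℕ) (hr : 1 ≤ r)
    (s ω : ℝ) (hs : 0 < s) (hω : 0 < ω) (n : ℕ) (q : Fin r → ℝ) :
    Filter.Tendsto
      (fun ℏ : ℝ => ℏ^n * ∑ j ∈ Finset.range (n + 1),
        (-1 : ℝ)^j *
          ((∏ m ∈ Finset.Icc (j+1) n, (((r : ℝ)/2 + s/ℏ - 1) + m)) /
            ((n - j).factorial : ℝ))
          * (ω * (∑ i, (q i)^2) / ℏ)^j / (j.factorial : ℝ))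
      (nhdsWithin 0 (Set.Ioi 0))
      (nhds ((-1 : ℝ)^n * (ω^n / (n.factorial : ℝ)) * ((∑ i, (q i)^2) - s/ω)^n)) := by
  set x : ℝ := ω * ∑ i, (q i) ^ 2 with hx
  have hcont : Continuous fun ℏ : ℝ => ∑ j ∈ Finset.range (n + 1),
      (-1 : ℝ) ^ j * ((∏ m ∈ Finset.Icc (j + 1) n, (ℏ * ((r : ℝ) / 2 - 1 + m) + s)) /
        ((n - j).factorial : ℝ)) * x ^ j / (j.factorial : ℝ) := by
    fun_prop
  have hlim : (-1 : ℝ) ^ n * (ω ^ n / (n.factorial : ℝ)) * ((∑ i, (q i) ^ 2) - s / ω) ^ n =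
      (s - x) ^ n / (n.factorial : ℝ) := by
    rw [show s - x = -1 * ω * ((∑ i, (q i) ^ 2) - s / ω) by rw [hx]; field_simp; ring,
      mul_pow, mul_pow]
    ring
  rw [hlim]
  refine ((hcont.tendsto' 0 _ ?_).mono_left nhdsWithin_le_nhds).congr' ?_
  · simpa using sum_neg_one_pow_mul_div_factorial s x n
  · filter_upwards [self_mem_nhdsWithin] with ℏ hℏ
    rw [Finset.mul_sum]
    refine Finset.sum_congr rfl fun j hj => ?_
    have hterm := pow_mul_laguerre_term (ne_of_gt hℏ) ((r : ℝ) / 2) s x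
      (Finset.mem_range_succ_iff.mp hj)
    linear_combination
      -((-1 : ℝ) ^ j / ((n - j).factorial : ℝ) / (j.factorial : ℝ)) * hterm
end

section
/- Let r ≥ 0 and 1 ≤ k ≤ r, and let q ∈ ℝ^{r+1} be such that sin(q_j − q_l) ≠ 0 for all j ≠ l. Define the complex-valued function S_k(q) = e_k( e^{2iq₁}, …, e^{2iq_{r+1}} ), the degree-k elementary symmetric polynomial in the exponentials e^{2iq_j}. Then: (i) −∑_{j=1}^{r+1} ( ∑_{l≠j} cot(q_j − q_l) ) ∂S_k/∂q_j = 2k(r+1−k) S_k; (ii) ∑_{j=1}^{r+1} ∂²S_k/∂q_j² = −4k S_k. Consequently, for every ℏ > 0, S_k satisfies the quantum eigenvalue equation −(ℏ²/2)ΔS_k − ℏ∑_j (∂W/∂q_j)(∂S_k/∂q_j) = 2kℏ(r+1−k+ℏ) S_k, where W = ∑_{j<l} log sin(q_j − q_l): the classical and quantum eigenfunctions coincide (no quantum corrections). -/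
/-- Partial derivative `∂f/∂q_j` of a complex-valued function on `ℝ^r`. -/
noncomputable def pdC {r : ℕ} (f : (Fin r → ℝ) → ℂ) (j : Fin r) (q : Fin r → ℝ) : ℂ :=
  fderiv ℝ f q (Pi.single j 1)

/-- The degree-`k` elementary symmetric polynomial of `z₁,…,z_n`. -/
noncomputable def esymC {n : ℕ} (k : ℕ) (z : Fin n → ℂ) : ℂ :=
  ∑ t ∈ Finset.univ.powersetCard k, ∏ i ∈ t, z i

/-- The sum of `∏ i ∈ t, z i` over the `k`-subsets `t` containing `j` but not `l`. -/
noncomputable def esymSep {n : ℕ} (k : ℕ) (z : Fin n → ℂ) (j l : Fin n) : ℂ :=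
  ∑ t ∈ Finset.univ.powersetCard k with j ∈ t ∧ l ∉ t, ∏ i ∈ t, z i

/-- The sum of `∏ i ∈ t, z i` over the `k`-subsets `t` containing `j`. -/
noncomputable def esymThrough {n : ℕ} (k : ℕ) (z : Fin n → ℂ) (j : Fin n) : ℂ :=
  ∑ t ∈ Finset.univ.powersetCard k, if j ∈ t then ∏ i ∈ t, z i else 0

lemma mul_esymSep_comm {n : ℕ} (k : ℕ) (z : Fin n → ℂ) {j l : Fin n} (h : j ≠ l) :
    z l * esymSep k z j l = z j * esymSep k z l j := by
  unfold esymSep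
  rw [Finset.mul_sum, Finset.mul_sum]
  refine Finset.sum_nbij' (fun t => insert l (t.erase j)) (fun t => insert j (t.erase l))
    ?_ ?_ ?_ ?_ ?_
  · intro t ht
    simp only [Finset.mem_filter, Finset.mem_powersetCard_univ] at ht ⊢
    obtain ⟨hc, hj, hl⟩ := ht
    refine ⟨?_, by simp, by simp [h]⟩
    rw [Finset.card_insert_of_notMem (by simp [hl]), Finset.card_erase_add_one hj, hc]
  · intro t ht
    simp only [Finset.mem_filter, Finset.mem_powersetCard_univ] at ht ⊢
    obtain ⟨hc, hl, hj⟩ := ht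
    refine ⟨?_, by simp, by simp [h.symm]⟩
    rw [Finset.card_insert_of_notMem (by simp [hj]), Finset.card_erase_add_one hl, hc]
  · intro t ht
    simp only [Finset.mem_filter] at ht
    rw [Finset.erase_insert (by simp [ht.2.2]), Finset.insert_erase ht.2.1]
  · intro t ht
    simp only [Finset.mem_filter] at ht
    rw [Finset.erase_insert (by simp [ht.2.2]), Finset.insert_erase ht.2.1]
  · intro t ht
    simp only [Finset.mem_filter] at ht
    rw [Finset.prod_insert (by simp [ht.2.2]), ← Finset.mul_prod_erase t z ht.2.1]
    ring

lemma esymThrough_sub {n : ℕ} (k : ℕ) (z : Fin n → ℂ) (j l : Fin n) :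
    esymThrough k z j - esymThrough k z l = esymSep k z j l - esymSep k z l j := by
  simp only [esymThrough, esymSep, Finset.sum_filter, ← Finset.sum_sub_distrib]
  refine Finset.sum_congr rfl fun t _ => ?_
  by_cases hj : j ∈ t <;> by_cases hl : l ∈ t <;> simp [hj, hl]

lemma sum_esymThrough {n : ℕ} (k : ℕ) (z : Fin n → ℂ) :
    ∑ j, esymThrough k z j = k * esymC k z := by
  simp only [esymThrough, esymC]
  rw [Finset.sum_comm, Finset.mul_sum]
  refine Finset.sum_congr rfl fun t ht => ?_
  rw [Finset.sum_ite_mem, Finset.univ_inter, Finset.sum_const,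
    (Finset.mem_powersetCard.1 ht).2, nsmul_eq_mul]

lemma sum_erase_esymSep {n : ℕ} (k : ℕ) (z : Fin n → ℂ) (j : Fin n) :
    ∑ l ∈ Finset.univ.erase j, esymSep k z j l = ((n : ℂ) - k) * esymThrough k z j := by
  rw [Finset.sum_erase _ (by simp [esymSep])]
  simp only [esymSep, esymThrough, Finset.sum_filter]
  rw [Finset.sum_comm, Finset.mul_sum]
  refine Finset.sum_congr rfl fun t ht => ?_
  have hcompl : ((tᶜ.card : ℕ) : ℂ) = n - k := by
    have := Finset.card_add_card_compl t
    rw [(Finset.mem_powersetCard.1 ht).2, Fintype.card_fin] at this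
    exact eq_sub_of_add_eq' (by exact_mod_cast this)
  simp only [← Finset.mem_compl (s := t)]
  by_cases hj : j ∈ t
  · simp only [hj, true_and, if_true]
    rw [Finset.sum_ite_mem, Finset.univ_inter, Finset.sum_const, nsmul_eq_mul, hcompl]
  · simp [hj]

lemma sum_esymSep {n : ℕ} (k : ℕ) (z : Fin n → ℂ) :
    ∑ j, ∑ l ∈ Finset.univ.erase j, esymSep k z j l = k * ((n : ℂ) - k) * esymC k z := by
  simp_rw [sum_erase_esymSep]
  rw [← Finset.mul_sum, sum_esymThrough]
  ring

lemma sum_sum_erase_comm {n : ℕ} (f : Fin n → Fin n → ℂ) :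
    ∑ j, ∑ l ∈ Finset.univ.erase j, f j l = ∑ j, ∑ l ∈ Finset.univ.erase j, f l j :=
  Finset.sum_comm' (by simp [ne_comm])

lemma sum_mul_esymThrough {n : ℕ} (k : ℕ) (z : Fin n → ℂ) (hz : Function.Injective z) :
    ∑ j, (∑ l ∈ Finset.univ.erase j, (z j + z l) / (z j - z l)) * esymThrough k z j
      = k * ((n : ℂ) - k) * esymC k z := by
  rw [← sum_esymSep]
  simp_rw [Finset.sum_mul]
  refine mul_left_cancel₀ (two_ne_zero (α := ℂ)) ?_
  conv_lhs => rw [two_mul]; enter [2]; rw [sum_sum_erase_comm]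
  conv_rhs => rw [two_mul]; enter [2]; rw [sum_sum_erase_comm]
  simp only [← Finset.sum_add_distrib]
  refine Finset.sum_congr rfl fun j _ => Finset.sum_congr rfl fun l hl => ?_
  have hlj : l ≠ j := Finset.ne_of_mem_erase hl
  have h1 : z j - z l ≠ 0 := sub_ne_zero.2 (hz.ne hlj.symm)
  have h2 : z l - z j ≠ 0 := sub_ne_zero.2 (hz.ne hlj)
  have h3 : (z l + z j) / (z l - z j) = -((z j + z l) / (z j - z l)) := by
    rw [← neg_sub (z j), div_neg, add_comm]
  rw [h3, neg_mul, ← sub_eq_add_neg, ← mul_sub, esymThrough_sub, div_mul_eq_mul_div,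
    div_eq_iff h1]
  linear_combination 2 * mul_esymSep_comm k z hlj.symm

lemma pdC_sum_mul_prod_exp {n : ℕ} (s : Finset (Finset (Fin n))) (c : Finset (Fin n) → ℂ)
    (j : Fin n) (q : Fin n → ℝ) :
    pdC (fun q => ∑ t ∈ s, c t * ∏ i ∈ t, Complex.exp (2 * Complex.I * (q i : ℂ))) j q
      = ∑ t ∈ s, (if j ∈ t then 2 * Complex.I * c t else 0) *
          ∏ i ∈ t, Complex.exp (2 * Complex.I * (q i : ℂ)) := by
  have hlin (t : Finset (Fin n)) :
      HasFDerivAt (fun q : Fin n → ℝ => ∑ i ∈ t, 2 * Complex.I * (q i : ℂ))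
        (∑ i ∈ t, (2 * Complex.I) •
          Complex.ofRealCLM.comp (ContinuousLinearMap.proj (R := ℝ) (φ := fun _ => ℝ) i)) q :=
    HasFDerivAt.fun_sum fun i _ => ((Complex.ofRealCLM.comp
      (ContinuousLinearMap.proj (R := ℝ) (φ := fun _ => ℝ) i)).hasFDerivAt).const_mul _
  have h := HasFDerivAt.fun_sum (u := s) fun t _ => ((hlin t).cexp).const_mul (c t)
  simp_rw [Complex.exp_sum] at h
  rw [pdC, h.fderiv]
  simp only [sum_apply, smul_apply,
    ContinuousLinearMap.comp_apply, ContinuousLinearMap.proj_apply, Complex.ofRealCLM_apply,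
    smul_eq_mul]
  refine Finset.sum_congr rfl fun t _ => ?_
  simp only [Pi.single_apply, apply_ite Complex.ofReal, Complex.ofReal_one, Complex.ofReal_zero,
    mul_ite, mul_zero, mul_one, Finset.sum_ite_eq']
  split_ifs <;> ring

lemma ofReal_cot_sub (a b : ℝ) :
    ((Real.cot (a - b) : ℝ) : ℂ) = Complex.I *
      ((Complex.exp (2 * Complex.I * a) + Complex.exp (2 * Complex.I * b)) /
        (Complex.exp (2 * Complex.I * a) - Complex.exp (2 * Complex.I * b))) := by
  rw [Complex.ofReal_cot, Complex.cot_eq_exp_ratio]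
  have ha : Complex.exp (2 * Complex.I * a)
      = Complex.exp (2 * Complex.I * b) * Complex.exp (2 * Complex.I * ((a - b : ℝ) : ℂ)) := by
    rw [← Complex.exp_add]; push_cast; ring_nf
  rw [ha, ← mul_add_one, ← mul_sub_one, mul_div_mul_left _ _ (Complex.exp_ne_zero _)]
  rw [← neg_sub (Complex.exp _) 1, mul_neg, div_neg, div_mul_eq_div_div_swap]
  simp [div_eq_mul_inv]
  ring

lemma exp_two_I_ne {a b : ℝ} (h : Real.sin (a - b) ≠ 0) :
    Complex.exp (2 * Complex.I * a) ≠ Complex.exp (2 * Complex.I * b) := by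
  intro he
  obtain ⟨m, hm⟩ := Complex.exp_eq_exp_iff_exists_int.1 he
  refine h (Real.sin_eq_zero_iff.2 ⟨m, ?_⟩)
  have h2 : (2 * Complex.I) * (a : ℂ) = (2 * Complex.I) * ((b + m * Real.pi : ℝ) : ℂ) := by
    rw [hm]; push_cast; ring
  have := Complex.ofReal_injective (mul_left_cancel₀ (by simp) h2)
  linarith

lemma pd_sum_log_sin {n : ℕ} (q : Fin n → ℝ)
    (hq : ∀ j l, j ≠ l → Real.sin (q j - q l) ≠ 0) (j : Fin n) :
    pd (fun q => ∑ a, ∑ b ∈ Finset.Ioi a, Real.log (Real.sin (q a - q b))) j q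
      = ∑ l ∈ Finset.univ.erase j, Real.cot (q j - q l) := by
  have h : HasFDerivAt (fun q : Fin n → ℝ => ∑ a, ∑ b ∈ Finset.Ioi a,
      Real.log (Real.sin (q a - q b))) (∑ a, ∑ b ∈ Finset.Ioi a,
        (Real.sin (q a - q b))⁻¹ • Real.cos (q a - q b) •
          (ContinuousLinearMap.proj (R := ℝ) (φ := fun _ => ℝ) a -
            ContinuousLinearMap.proj (R := ℝ) (φ := fun _ => ℝ) b)) q :=
    HasFDerivAt.fun_sum fun a _ => HasFDerivAt.fun_sum fun b hb =>
      (((ContinuousLinearMap.proj (R := ℝ) (φ := fun _ => ℝ) a -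
        ContinuousLinearMap.proj (R := ℝ) (φ := fun _ => ℝ) b :
          (Fin n → ℝ) →L[ℝ] ℝ).hasFDerivAt (x := q)).sin).log
        (hq a b (Finset.mem_Ioi.1 hb).ne)
  rw [pd, h.fderiv]
  simp only [sum_apply, smul_apply,
    sub_apply, ContinuousLinearMap.proj_apply, smul_eq_mul]
  have hterm (a b : Fin n) : (Real.sin (q a - q b))⁻¹ * (Real.cos (q a - q b) *
      ((Pi.single j 1 : Fin n → ℝ) a - (Pi.single j 1 : Fin n → ℝ) b))
      = (if a = j then Real.cot (q a - q b) else 0)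
        + (if b = j then Real.cot (q b - q a) else 0) := by
    have h1 : Real.cot (q b - q a) = -Real.cot (q a - q b) := by
      rw [← neg_sub (q a), Real.cot_eq_cos_div_sin, Real.cot_eq_cos_div_sin, Real.cos_neg,
        Real.sin_neg, div_neg]
    rw [h1, Real.cot_eq_cos_div_sin, Pi.single_apply, Pi.single_apply]
    split_ifs <;> ring
  simp_rw [hterm, Finset.sum_add_distrib]
  have hfst : (∑ a, ∑ b ∈ Finset.Ioi a, if a = j then Real.cot (q a - q b) else 0)
      = ∑ b ∈ Finset.Ioi j, Real.cot (q j - q b) := by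
    rw [Finset.sum_eq_single j (fun a _ ha => by simp [ha]) (by simp)]
    simp
  have hsnd : (∑ a, ∑ b ∈ Finset.Ioi a, if b = j then Real.cot (q b - q a) else 0)
      = ∑ a ∈ Finset.Iio j, Real.cot (q j - q a) := by
    rw [Finset.sum_comm' (t' := Finset.univ) (s' := fun b => Finset.Iio b) (by simp)]
    rw [Finset.sum_eq_single j (fun a _ ha => by simp [ha]) (by simp)]
    simp
  rw [hfst, hsnd, ← Finset.sum_union]
  · congr 1
    ext b
    simp [lt_or_lt_iff_ne, eq_comm]
  · exact Finset.disjoint_left.2 fun b hb hb' =>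
      lt_asymm (Finset.mem_Ioi.1 hb) (Finset.mem_Iio.1 hb')

/-- The elementary excitations of the reduced `A_r` Sutherland system:
`S_k = e_k(e^{2iq₁},…,e^{2iq_{r+1}})` satisfies (i) `Â S_k = 2k(r+1−k) S_k`,
(ii) `Δ S_k = −4k S_k`, and hence (iii) `Ĥ S_k = 2kℏ(r+1−k+ℏ) S_k`: classical and
quantum eigenfunctions coincide (no quantum corrections). -/
theorem A_series_sutherland_eigenfunctions (r k : ℕ) (hk1 : 1 ≤ k) (hk2 : k ≤ r)
    (S : (Fin (r+1) → ℝ) → ℂ)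
    (hS : ∀ q, S q = esymC k (fun j => Complex.exp (2 * Complex.I * (q j : ℂ))))
    (W : (Fin (r+1) → ℝ) → ℝ)
    (hW : ∀ q, W q = ∑ j, ∑ l ∈ Finset.Ioi j, Real.log (Real.sin (q j - q l))) :
    ∀ q : Fin (r+1) → ℝ, (∀ j l, j ≠ l → Real.sin (q j - q l) ≠ 0) →
      (-(∑ j, ((∑ l ∈ Finset.univ.erase j, Real.cot (q j - q l) : ℝ) : ℂ) * pdC S j q)
          = 2 * (k : ℂ) * ((r : ℂ) + 1 - k) * S q)
      ∧ (∑ j, pdC (pdC S j) j q = -4 * (k : ℂ) * S q)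
      ∧ (∀ ℏ : ℝ, 0 < ℏ →
          -((ℏ : ℂ)^2/2) * (∑ j, pdC (pdC S j) j q)
            - (ℏ : ℂ) * (∑ j, ((pd W j q : ℝ) : ℂ) * pdC S j q)
          = 2 * (k : ℂ) * (ℏ : ℂ) * ((r : ℂ) + 1 - k + (ℏ : ℂ)) * S q) := by
  intro q hq
  set z : Fin (r + 1) → ℂ := fun j => Complex.exp (2 * Complex.I * (q j : ℂ)) with hz
  have hinj : Function.Injective z := fun a b hab => by
    by_contra hne
    exact exp_two_I_ne (hq a b hne) hab
  have hSf : S = fun q => ∑ t ∈ Finset.univ.powersetCard k, (fun _ => (1 : ℂ)) t *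
      ∏ i ∈ t, Complex.exp (2 * Complex.I * (q i : ℂ)) := by
    funext q
    simp [hS, esymC]
  have hD (j : Fin (r + 1)) : pdC S j = fun q => ∑ t ∈ Finset.univ.powersetCard k,
      (fun t => if j ∈ t then 2 * Complex.I * 1 else 0) t *
        ∏ i ∈ t, Complex.exp (2 * Complex.I * (q i : ℂ)) := by
    funext q
    rw [hSf, pdC_sum_mul_prod_exp]
  have hD1 (j : Fin (r + 1)) : pdC S j q = 2 * Complex.I * esymThrough k z j := by
    rw [hD, esymThrough, Finset.mul_sum]
    refine Finset.sum_congr rfl fun t _ => ?_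
    by_cases hj : j ∈ t <;> simp [hj, hz]
  have hD2 (j : Fin (r + 1)) : pdC (pdC S j) j q = -4 * esymThrough k z j := by
    rw [hD, pdC_sum_mul_prod_exp, esymThrough, Finset.mul_sum]
    refine Finset.sum_congr rfl fun t _ => ?_
    by_cases hj : j ∈ t
    · simp only [hj, if_true, hz]
      linear_combination 4 * (∏ i ∈ t, Complex.exp (2 * Complex.I * (q i : ℂ))) *
        Complex.I_mul_I
    · simp [hj]
  have hclassical : -(∑ j, ((∑ l ∈ Finset.univ.erase j, Real.cot (q j - q l) : ℝ) : ℂ) *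
      pdC S j q) = 2 * (k : ℂ) * ((r : ℂ) + 1 - k) * S q := by
    have hterm (j : Fin (r + 1)) :
        ((∑ l ∈ Finset.univ.erase j, Real.cot (q j - q l) : ℝ) : ℂ) * pdC S j q
          = -2 * ((∑ l ∈ Finset.univ.erase j, (z j + z l) / (z j - z l)) *
            esymThrough k z j) := by
      rw [hD1, Complex.ofReal_sum]
      simp_rw [ofReal_cot_sub]
      rw [← Finset.mul_sum]
      linear_combination 2 * (∑ l ∈ Finset.univ.erase j, (z j + z l) / (z j - z l)) *
        esymThrough k z j * Complex.I_mul_I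
    simp_rw [hterm]
    rw [← Finset.mul_sum, sum_mul_esymThrough k z hinj, hS]
    push_cast
    ring
  have hlaplace : ∑ j, pdC (pdC S j) j q = -4 * (k : ℂ) * S q := by
    simp_rw [hD2]
    rw [← Finset.mul_sum, sum_esymThrough, hS, mul_assoc]
  refine ⟨hclassical, hlaplace, fun ℏ _ => ?_⟩
  have hWf : W = fun q => ∑ j, ∑ l ∈ Finset.Ioi j, Real.log (Real.sin (q j - q l)) := funext hW
  simp_rw [hWf, pd_sum_log_sin q hq]
  rw [hlaplace]
  linear_combination (ℏ : ℂ) * hclassical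
end

section
/- Let r ≥ 2 and let q ∈ ℝ^r have pairwise distinct squares q_j². Define φ(q) = q₁ q₂ ⋯ q_r and the D_r Calogero prepotential W = ∑_{j<k}^r log(q_j² − q_k²) − (1/2) q². Then: (i) Δφ = ∑_{j=1}^r ∂²φ/∂q_j² = 0; (ii) −∑_{j=1}^r ∂W/∂q_j ∂φ/∂q_j = r φ, i.e. explicitly −∑_j ( ∑_{k≠j} 2q_j/(q_j² − q_k²) − q_j ) ∂φ/∂q_j = rφ. Consequently, for every ℏ > 0, −(ℏ²/2)Δφ − ℏ∑_j (∂W/∂q_j)(∂φ/∂q_j) = rℏ φ: the product q₁⋯q_r is simultaneously a classical eigenfunction (eigenvalue r) and a quantum eigenfunction (eigenvalue rℏ) of the D_r Calogero system, without quantum corrections. -/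
/-- Partial derivatives of a product of coordinates. -/
lemma pd_prod_coord {r : ℕ} (s : Finset (Fin r)) (j : Fin r) (q : Fin r → ℝ) :
    pd (fun p => ∏ i ∈ s, p i) j q = if j ∈ s then ∏ i ∈ s.erase j, q i else 0 := by
  have h := hasFDerivAt_finsetProd (𝕜 := ℝ) (u := s) (x := q)
  rw [pd, h.fderiv]
  simp [Pi.single_apply]

/-- Each coordinate times its complementary product gives the full product. -/
lemma coord_mul_prod_erase {r : ℕ} (j : Fin r) (q : Fin r → ℝ) :
    q j * ∏ i ∈ Finset.univ.erase j, q i = ∏ i, q i :=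
  Finset.mul_prod_erase _ _ (Finset.mem_univ j)

/-- A double sum of an antisymmetric function over distinct pairs vanishes. -/
lemma sum_sum_erase_eq_zero_of_antisymm {ι : Type*} [Fintype ι] [DecidableEq ι] (f : ι → ι → ℝ)
    (hf : ∀ i j, f j i = -f i j) : ∑ i, ∑ j ∈ Finset.univ.erase i, f i j = 0 := by
  have hdiag : ∀ i, f i i = 0 := fun i => by linarith [hf i i]
  have hfull : ∀ i, ∑ j ∈ Finset.univ.erase i, f i j = ∑ j, f i j := fun i =>
    Finset.sum_erase _ (hdiag i)
  have hneg : ∑ i, ∑ j, f i j = -∑ i, ∑ j, f i j := by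
    conv_lhs => rw [Finset.sum_comm]
    rw [← Finset.sum_neg_distrib]
    refine Finset.sum_congr rfl fun i _ => ?_
    rw [← Finset.sum_neg_distrib]
    exact Finset.sum_congr rfl fun j _ => hf i j
  simp only [hfull]
  linarith

/-- The Fréchet derivative of the `D_r` Calogero prepotential. -/
lemma fderiv_prepotential_apply {r : ℕ} {q : Fin r → ℝ}
    (hqd : Function.Injective fun j => (q j)^2) (v : Fin r → ℝ) :
    fderiv ℝ (fun p : Fin r → ℝ =>
        (∑ j, ∑ l ∈ Finset.Ioi j, Real.log ((p j)^2 - (p l)^2)) - (1/2) * (∑ j, (p j)^2)) q v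
      = (∑ j, ∑ l ∈ Finset.Ioi j, 2 * (q j * v j - q l * v l) / ((q j)^2 - (q l)^2))
        - ∑ j, q j * v j := by
  have hsq (j : Fin r) : HasFDerivAt (fun p : Fin r → ℝ => (p j)^2)
      ((2 * q j) • ContinuousLinearMap.proj (R := ℝ) (φ := fun _ : Fin r => ℝ) j) q := by
    simpa using (hasFDerivAt_apply (𝕜 := ℝ) j q).pow 2
  have hlog (j l : Fin r) (hl : l ∈ Finset.Ioi j) :=
    ((hsq j).fun_sub (hsq l)).log
      (sub_ne_zero.2 fun h => (Finset.mem_Ioi.1 hl).ne (hqd h))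
  have hW := (HasFDerivAt.fun_sum fun j (_ : j ∈ Finset.univ) =>
      HasFDerivAt.fun_sum fun l hl => hlog j l hl).fun_sub
    ((HasFDerivAt.fun_sum fun j (_ : j ∈ Finset.univ) => hsq j).const_mul (1/2))
  rw [hW.fderiv]
  simp only [sub_apply, sum_apply,
    smul_apply, ContinuousLinearMap.proj_apply, smul_eq_mul, Finset.mul_sum]
  congr 1
  · refine Finset.sum_congr rfl fun j _ => Finset.sum_congr rfl fun l _ => ?_
    rw [div_eq_mul_inv]
    ring
  · exact Finset.sum_congr rfl fun j _ => by ring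

/-- A linear functional is determined by the partial derivatives. -/
lemma sum_pd_mul {r : ℕ} (f : (Fin r → ℝ) → ℝ) (q v : Fin r → ℝ) :
    ∑ j, pd f j q * v j = fderiv ℝ f q v := by
  conv_rhs => rw [pi_eq_sum_univ' v, map_sum]
  refine Finset.sum_congr rfl fun j _ => ?_
  rw [map_smul, smul_eq_mul, mul_comm]
  rfl

/-- The special elementary excitation `φ = q₁q₂⋯q_r` of the reduced `D_r` Calogero
system is (i) harmonic, (ii) a classical eigenfunction with eigenvalue `r`, and hence
(iii) a quantum eigenfunction with eigenvalue `rℏ` (no quantum corrections). -/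
theorem D_series_special_excitation (r : ℕ) (hr : 2 ≤ r) (q : Fin r → ℝ)
    (hqd : Function.Injective fun j => (q j)^2)
    (φ W : (Fin r → ℝ) → ℝ)
    (hφ : ∀ p, φ p = ∏ j, p j)
    (hW : ∀ p, W p = (∑ j, ∑ l ∈ Finset.Ioi j, Real.log ((p j)^2 - (p l)^2))
        - (1/2) * (∑ j, (p j)^2)) :
    (∑ j, pd (pd φ j) j q = 0)
    ∧ (-(∑ j, (∑ l ∈ Finset.univ.erase j, 2 * q j / ((q j)^2 - (q l)^2) - q j) *
          pd φ j q) = (r : ℝ) * φ q)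
    ∧ (∀ ℏ : ℝ, 0 < ℏ →
        -(ℏ^2/2) * (∑ j, pd (pd φ j) j q) - ℏ * (∑ j, pd W j q * pd φ j q)
          = (r : ℝ) * ℏ * φ q) := by
  obtain rfl : φ = fun p => ∏ j, p j := funext hφ
  obtain rfl := funext hW
  have hpd (j : Fin r) :
      pd (fun p : Fin r → ℝ => ∏ i, p i) j = fun p => ∏ i ∈ Finset.univ.erase j, p i := by
    funext p
    simp [pd_prod_coord]
  have hharm : ∑ j, pd (pd (fun p : Fin r → ℝ => ∏ i, p i) j) j q = 0 :=
    Finset.sum_eq_zero fun j _ => by rw [hpd, pd_prod_coord]; simp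
  refine ⟨hharm, ?_, fun ℏ _ => ?_⟩
  · have hterm (j : Fin r) :
        (∑ l ∈ Finset.univ.erase j, 2 * q j / ((q j)^2 - (q l)^2) - q j) *
            pd (fun p : Fin r → ℝ => ∏ i, p i) j q
          = ∑ l ∈ Finset.univ.erase j, 2 * (∏ i, q i) / ((q j)^2 - (q l)^2) - ∏ i, q i := by
      rw [hpd, sub_mul, Finset.sum_mul, coord_mul_prod_erase]
      congr 1
      refine Finset.sum_congr rfl fun l _ => ?_
      rw [← coord_mul_prod_erase j q]
      ring
    simp only [hterm, Finset.sum_sub_distrib]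
    rw [sum_sum_erase_eq_zero_of_antisymm
      (fun j l => 2 * (∏ i, q i) / ((q j)^2 - (q l)^2))
      fun j l => by rw [← neg_sub, div_neg]]
    simp
  · rw [hharm, sum_pd_mul, fderiv_prepotential_apply hqd]
    simp only [hpd, coord_mul_prod_erase]
    simp
    ring
end
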